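/- arXiv:math/0503296 — 2 statements merged into one kernel-verified Lean document; each statement's English description precedes it below -/
import Mathlib

section
/- Suppose N > 0. Then F e_{N−1} = 0; more generally F^l e_n = 0 whenever n < N ≤ n + l; consequently the 𝕜-subspace W_N of V_N spanned by e_0, e_1, …, e_{N−1} is invariant under each of the operators K, K⁻¹, E, F. -/
open Finsupp

noncomputable section

/-- The ground field `𝕜 = ℂ(v)`. -/
abbrev kk : Type := RatFunc ℂ

/-- The variable `v`. -/
def v : kk := RatFunc.X

/-- `q = v²`. -/
def qv : kk := v ^ 2

/-- The quantum integer `[n] = (vⁿ − v⁻ⁿ)/(v − v⁻¹)`, for `n : ℤ`. -/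
def qint (n : ℤ) : kk := (v ^ n - v ^ (-n)) / (v - v⁻¹)

/-- The module `V_N`, a `𝕜`-vector space with basis `(e_i)_{i ∈ ℕ}`. -/
abbrev V : Type := ℕ →₀ kk

/-- The basis vector `e i`. -/
def e (i : ℕ) : V := Finsupp.single i 1

/-- `K e_i = v^{N−1−2i} e_i`. -/
def Kop (N : ℤ) : Module.End kk V :=
  Finsupp.lsum kk fun i => LinearMap.toSpanSingleton kk V
    (Finsupp.single i (v ^ (N - 1 - 2 * (i : ℤ))))

/-- `K⁻¹ e_i = v^{−(N−1−2i)} e_i`. -/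
def KopInv (N : ℤ) : Module.End kk V :=
  Finsupp.lsum kk fun i => LinearMap.toSpanSingleton kk V
    (Finsupp.single i (v ^ (-(N - 1 - 2 * (i : ℤ)))))

/-- `E e_i = ((1−q^i)/(1−q)) e_{i−1}` for `i ≥ 1`, `E e_0 = 0` (note that the
coefficient `(1−q^0)/(1−q)` vanishes, so the truncated subtraction `i - 1` is harmless). -/
def Eop : Module.End kk V :=
  Finsupp.lsum kk fun i => LinearMap.toSpanSingleton kk V
    (Finsupp.single (i - 1) ((1 - qv ^ i) / (1 - qv)))

/-- `F e_i = v^i [N−1−i] e_{i+1}`. -/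
def Fop (N : ℤ) : Module.End kk V :=
  Finsupp.lsum kk fun i => LinearMap.toSpanSingleton kk V
    (Finsupp.single (i + 1) (v ^ (i : ℕ) * qint (N - 1 - (i : ℤ))))

end
noncomputable section

/-- The subspace `W_N ⊆ V_N` spanned by `e_0, …, e_{N−1}`. -/
def W (N : ℤ) : Submodule kk V :=
  Submodule.span kk {f : V | ∃ i : ℕ, (i : ℤ) < N ∧ f = e i}

theorem single_mem_W {N : ℤ} {i : ℕ} (hi : (i : ℤ) < N) (c : kk) :
    (Finsupp.single i c : V) ∈ W N := by
  have h : (Finsupp.single i c : V) = c • e i := by simp [e]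
  rw [h]
  exact (W N).smul_mem c (Submodule.subset_span ⟨i, hi, rfl⟩)

/-- To check that `W N` is invariant under an operator, test it on the spanning vectors. -/
theorem map_mem_W {N : ℤ} (T : Module.End kk V)
    (hT : ∀ i : ℕ, (i : ℤ) < N → T (e i) ∈ W N) : ∀ x ∈ W N, T x ∈ W N := by
  have h : W N ≤ (W N).comap T := by
    refine Submodule.span_le.2 ?_
    rintro _ ⟨i, hi, rfl⟩
    exact hT i hi
  exact fun x hx => h hx

theorem Kop_e (N : ℤ) (i : ℕ) :
    Kop N (e i) = Finsupp.single i (v ^ (N - 1 - 2 * (i : ℤ))) := by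
  simp [Kop, e]

theorem KopInv_e (N : ℤ) (i : ℕ) :
    KopInv N (e i) = Finsupp.single i (v ^ (-(N - 1 - 2 * (i : ℤ)))) := by
  simp [KopInv, e]

theorem Eop_e (i : ℕ) :
    Eop (e i) = Finsupp.single (i - 1) ((1 - qv ^ i) / (1 - qv)) := by
  simp [Eop, e]

theorem Fop_e (N : ℤ) (i : ℕ) :
    Fop N (e i) = Finsupp.single (i + 1) (v ^ i * qint (N - 1 - (i : ℤ))) := by
  simp [Fop, e]

theorem Fop_e_eq_smul (N : ℤ) (i : ℕ) :
    Fop N (e i) = (v ^ i * qint (N - 1 - (i : ℤ))) • e (i + 1) := by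
  rw [Fop_e, e, Finsupp.smul_single, smul_eq_mul, mul_one]

theorem Fop_e_eq_zero {N : ℤ} {i : ℕ} (hi : (i : ℤ) + 1 = N) : Fop N (e i) = 0 := by
  have h : N - 1 - (i : ℤ) = 0 := by omega
  simp [Fop_e, h, qint]

theorem Fop_pow_e_eq_zero {N : ℤ} (l : ℕ) :
    ∀ n : ℕ, (n : ℤ) < N → N ≤ (n : ℤ) + (l : ℤ) → (Fop N ^ l) (e n) = 0 := by
  induction l with
  | zero => intro n h₁ h₂; push_cast at h₂; omega
  | succ l ih =>
    intro n h₁ h₂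
    rw [pow_succ, Module.End.mul_apply]
    by_cases hn : (n : ℤ) + 1 = N
    · rw [Fop_e_eq_zero hn, map_zero]
    · rw [Fop_e_eq_smul, map_smul, ih (n + 1) (by push_cast; omega) (by push_cast at h₂ ⊢; omega),
        smul_zero]

/-- For `N > 0`: `F e_{N−1} = 0`; more generally `F^l e_n = 0` whenever `n < N ≤ n + l`;
consequently `W_N` is invariant under `K`, `K⁻¹`, `E` and `F`. -/
theorem WN_invariant (N : ℤ) (hN : 0 < N) :
    Fop N (e ((N - 1).toNat)) = 0 ∧
    (∀ n l : ℕ, (n : ℤ) < N → N ≤ (n : ℤ) + (l : ℤ) → (Fop N ^ l) (e n) = 0) ∧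
    (∀ x ∈ W N, Kop N x ∈ W N) ∧ (∀ x ∈ W N, KopInv N x ∈ W N) ∧
    (∀ x ∈ W N, Eop x ∈ W N) ∧ (∀ x ∈ W N, Fop N x ∈ W N) := by
  refine ⟨Fop_e_eq_zero (by omega), fun n l => Fop_pow_e_eq_zero l n,
    map_mem_W _ fun i hi => ?_, map_mem_W _ fun i hi => ?_,
    map_mem_W _ fun i hi => ?_, map_mem_W _ fun i hi => ?_⟩
  · rw [Kop_e]
    exact single_mem_W hi _
  · rw [KopInv_e]
    exact single_mem_W hi _
  · rw [Eop_e]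
    exact single_mem_W (by omega) _
  · by_cases h : (i : ℤ) + 1 = N
    · rw [Fop_e_eq_zero h]
      exact (W N).zero_mem
    · rw [Fop_e]
      exact single_mem_W (by push_cast; omega) _

end
end

section
/- Let 𝒜 be a (possibly noncommutative) algebra over ℤ[q, q⁻¹] and let A, B be m×m right-quantum matrices over 𝒜 such that every entry of A commutes with every entry of B. Then the product AB is a right-quantum matrix. -/
open LaurentPolynomial

/-- An `m×m` matrix `A` over an algebra `𝒜` over `ℤ[q,q⁻¹]` is right-quantum if every
`2×2` submatrix (rows `i < i'`, columns `j < j'`) is right-quantum: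
`a_{ij} a_{i'j} = q a_{i'j} a_{ij}` and `a_{ij'} a_{i'j'} = q a_{i'j'} a_{ij'}`
(column `q`-commutations), and
`a_{ij} a_{i'j'} = a_{i'j'} a_{ij} + q a_{i'j} a_{ij'} − q⁻¹ a_{ij'} a_{i'j}`
(cross commutation). -/
def RightQuantum {m : ℕ} {𝒜 : Type*} [Ring 𝒜] [Algebra (LaurentPolynomial ℤ) 𝒜]
    (A : Matrix (Fin m) (Fin m) 𝒜) : Prop :=
  ∀ i i' j j' : Fin m, i < i' → j < j' →
    A i j * A i' j = algebraMap (LaurentPolynomial ℤ) 𝒜 (T 1) * (A i' j * A i j) ∧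
    A i j' * A i' j' = algebraMap (LaurentPolynomial ℤ) 𝒜 (T 1) * (A i' j' * A i j') ∧
    A i j * A i' j' = A i' j' * A i j +
      algebraMap (LaurentPolynomial ℤ) 𝒜 (T 1) * (A i' j * A i j') -
      algebraMap (LaurentPolynomial ℤ) 𝒜 (T (-1)) * (A i j' * A i' j)

/-- The quantum minor `a_{ij} a_{i'j'} - q a_{i'j} a_{ij'}`. -/
def quantumMinor {m : ℕ} {𝒜 : Type*} [Ring 𝒜] (q : 𝒜) (A : Matrix (Fin m) (Fin m) 𝒜)
    (i i' j j' : Fin m) : 𝒜 :=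
  A i j * A i' j' - q * (A i' j * A i j')

theorem algebraMap_T_one_mul_T_neg_one {𝒜 : Type*} [Ring 𝒜]
    [Algebra (LaurentPolynomial ℤ) 𝒜] (x : 𝒜) :
    algebraMap (LaurentPolynomial ℤ) 𝒜 (T 1) *
      (algebraMap (LaurentPolynomial ℤ) 𝒜 (T (-1)) * x) = x := by
  rw [← mul_assoc, ← map_mul, ← T_add]
  simp

theorem algebraMap_T_neg_one_mul_T_one {𝒜 : Type*} [Ring 𝒜]
    [Algebra (LaurentPolynomial ℤ) 𝒜] (x : 𝒜) :
    algebraMap (LaurentPolynomial ℤ) 𝒜 (T (-1)) *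
      (algebraMap (LaurentPolynomial ℤ) 𝒜 (T 1) * x) = x := by
  rw [← mul_assoc, ← map_mul, ← T_add]
  simp

/-- A matrix is right-quantum exactly when its quantum minors are
`q`-alternating in the columns. -/
theorem rightQuantum_iff_quantumMinor {m : ℕ} {𝒜 : Type*} [Ring 𝒜]
    [Algebra (LaurentPolynomial ℤ) 𝒜] (A : Matrix (Fin m) (Fin m) 𝒜) :
    RightQuantum A ↔ ∀ i i' : Fin m, i < i' →
      (∀ j, quantumMinor (algebraMap (LaurentPolynomial ℤ) 𝒜 (T 1)) A i i' j j = 0) ∧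
      ∀ j j', j < j' →
        quantumMinor (algebraMap (LaurentPolynomial ℤ) 𝒜 (T 1)) A i i' j' j =
          -(algebraMap (LaurentPolynomial ℤ) 𝒜 (T 1) *
            quantumMinor (algebraMap (LaurentPolynomial ℤ) 𝒜 (T 1)) A i i' j j') := by
  have hqr := algebraMap_T_one_mul_T_neg_one (𝒜 := 𝒜)
  have hrq := algebraMap_T_neg_one_mul_T_one (𝒜 := 𝒜)
  simp only [RightQuantum, quantumMinor]
  generalize algebraMap (LaurentPolynomial ℤ) 𝒜 (T 1) = q at *
  generalize algebraMap (LaurentPolynomial ℤ) 𝒜 (T (-1)) = r at *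
  constructor
  · intro h i i' hi
    refine ⟨fun j => sub_eq_zero.mpr ?_, fun j j' hj => ?_⟩
    · rcases lt_or_ge i j with hij | hij
      · exact (h i i' i j hi hij).2.1
      · exact (h i i' j i' hi (hij.trans_lt hi)).1
    · rw [(h i i' j j' hi hj).2.2]
      simp only [mul_sub, mul_add, hqr]
      abel
  · intro h i i' j j' hi hj
    refine ⟨sub_eq_zero.mp ((h i i' hi).1 j), sub_eq_zero.mp ((h i i' hi).1 j'), ?_⟩
    have h' := congrArg (r * ·) ((h i i' hi).2 j j' hj)
    simp only [mul_sub, mul_neg, hrq] at h'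
    rw [← sub_eq_zero] at h' ⊢
    rw [← h']
    abel

theorem Fin.sum_sum_eq_sum_sum_lt {m : ℕ} {M : Type*} [AddCommMonoid M]
    (f : Fin m → Fin m → M) (hf : ∀ k, f k k = 0) :
    ∑ k, ∑ l, f k l = ∑ k, ∑ l, if k < l then f k l + f l k else 0 := by
  have hsplit : ∀ k l, f k l = (if k < l then f k l else 0) + if l < k then f k l else 0 := by
    intro k l
    rcases lt_trichotomy k l with h | rfl | h
    · simp [h, h.not_gt]
    · simp [hf]
    · simp [h, h.not_gt]
  calc ∑ k, ∑ l, f k l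
      = (∑ k, ∑ l, if k < l then f k l else 0) + ∑ k, ∑ l, if l < k then f k l else 0 := by
        simp only [← Finset.sum_add_distrib, ← hsplit]
    _ = (∑ k, ∑ l, if k < l then f k l else 0) + ∑ k, ∑ l, if k < l then f l k else 0 := by
        rw [Finset.sum_comm (f := fun k l => if l < k then f k l else 0)]
    _ = ∑ k, ∑ l, if k < l then f k l + f l k else 0 := by
        simp only [← Finset.sum_add_distrib, ← ite_add_zero]

/-- The Cauchy–Binet formula for `2 × 2` quantum minors. -/
theorem quantumMinor_mul {m : ℕ} {𝒜 : Type*} [Ring 𝒜] (q : 𝒜) (hq : ∀ x, Commute q x)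
    (A B : Matrix (Fin m) (Fin m) 𝒜) (hcomm : ∀ i j k l, Commute (A i j) (B k l))
    {i i' : Fin m} (hdiag : ∀ k, quantumMinor q A i i' k k = 0)
    (hswap : ∀ k l, k < l → quantumMinor q A i i' l k = -(q * quantumMinor q A i i' k l))
    (j j' : Fin m) :
    quantumMinor q (A * B) i i' j j' =
      ∑ k, ∑ l, if k < l then quantumMinor q A i i' k l * quantumMinor q B k l j j' else 0 := by
  have hprod : ∀ a b c d : Fin m, (A * B) a c * (A * B) b d =
      ∑ k, ∑ l, A a k * A b l * (B k c * B l d) := by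
    intro a b c d
    simp only [Matrix.mul_apply, Finset.sum_mul_sum]
    refine Finset.sum_congr rfl fun k _ => Finset.sum_congr rfl fun l _ => ?_
    exact (hcomm b l k c).symm.mul_mul_mul_comm _ _
  have hexpand : quantumMinor q (A * B) i i' j j' =
      ∑ k, ∑ l, quantumMinor q A i i' k l * (B k j * B l j') := by
    rw [quantumMinor, hprod, hprod]
    simp only [quantumMinor, Finset.mul_sum, ← Finset.sum_sub_distrib, sub_mul, mul_assoc]
  rw [hexpand, Fin.sum_sum_eq_sum_sum_lt _ fun k => by rw [hdiag, zero_mul]]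
  refine Finset.sum_congr rfl fun k _ => Finset.sum_congr rfl fun l _ => ?_
  split_ifs with hkl
  · rw [hswap k l hkl, (hq _).eq, quantumMinor.eq_1 q B, mul_sub, neg_mul, mul_assoc,
      sub_eq_add_neg]
  · rfl

/-- If `A` and `B` are `m×m` right-quantum matrices over a possibly noncommutative
algebra `𝒜` over `ℤ[q,q⁻¹]` and every entry of `A` commutes with every entry of `B`,
then the product `AB` is right-quantum. -/
theorem rightQuantum_mul {m : ℕ} {𝒜 : Type*} [Ring 𝒜] [Algebra (LaurentPolynomial ℤ) 𝒜]
    (A B : Matrix (Fin m) (Fin m) 𝒜) (hA : RightQuantum A) (hB : RightQuantum B)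
    (hcomm : ∀ i j k l : Fin m, Commute (A i j) (B k l)) :
    RightQuantum (A * B) := by
  rw [rightQuantum_iff_quantumMinor] at hA hB ⊢
  have hq : ∀ x : 𝒜, Commute (algebraMap (LaurentPolynomial ℤ) 𝒜 (T 1)) x :=
    fun x => Algebra.commutes _ x
  intro i i' hi
  obtain ⟨hdiag, hswap⟩ := hA i i' hi
  have hmul := quantumMinor_mul _ hq A B hcomm hdiag hswap
  refine ⟨fun j => ?_, fun j j' hj => ?_⟩
  · rw [hmul]
    refine Finset.sum_eq_zero fun k _ => Finset.sum_eq_zero fun l _ => ?_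
    split_ifs with hkl
    · rw [(hB k l hkl).1 j, mul_zero]
    · rfl
  · simp only [hmul, Finset.mul_sum, ← Finset.sum_neg_distrib]
    refine Finset.sum_congr rfl fun k _ => Finset.sum_congr rfl fun l _ => ?_
    split_ifs with hkl
    · rw [(hB k l hkl).2 j j' hj, mul_neg, (hq _).symm.left_comm]
    · simp
end
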